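/- Let 1 ≤ q < p < ∞. Then for every measurable function f on ℝⁿ, ‖f‖_{M^p_q} ≤ 2 (q/(p − q))^{1/p} ‖f‖_{L^{p,∞}}; in particular the weak Lebesgue space L^{p,∞} is contained in the Morrey space M^p_q. -/

import Mathlib

open MeasureTheory ENNReal

noncomputable section

/-- `ℝⁿ` with the Euclidean norm. -/
abbrev En (n : ℕ) := EuclideanSpace ℝ (Fin n)

/-- The open cube in `ℝⁿ` centered at `c` with half side length `r`. -/
def cube {n : ℕ} (c : En n) (r : ℝ) : Set (En n) := {y | ∀ i, |y i - c i| < r}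

/-- Morrey norm `‖f‖_{M^p_q}`. -/
def morreyNorm {n : ℕ} (p q : ℝ) (f : En n → ℂ) : ℝ≥0∞ :=
  ⨆ (c : En n) (r : ℝ) (_ : 0 < r),
    volume (cube c r) ^ (1 / p - 1 / q) *
      (∫⁻ y in cube c r, (‖f y‖₊ : ℝ≥0∞) ^ q) ^ (1 / q)

/-- Weak Morrey norm `‖f‖_{WM^p_q}`. -/
def weakMorreyNorm {n : ℕ} (p q : ℝ) (f : En n → ℂ) : ℝ≥0∞ :=
  ⨆ (c : En n) (r : ℝ) (_ : 0 < r),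
    volume (cube c r) ^ (1 / p - 1 / q) *
      ⨆ (t : ℝ) (_ : 0 < t),
        (ENNReal.ofReal t ^ q * volume {y ∈ cube c r | t < ‖f y‖}) ^ (1 / q)

/-- Weak Lebesgue quasinorm `‖f‖_{L^{p,∞}}`. -/
def weakLpNorm {n : ℕ} (p : ℝ) (f : En n → ℂ) : ℝ≥0∞ :=
  ⨆ (t : ℝ) (_ : 0 < t),
    ENNReal.ofReal t * volume {x : En n | t < ‖f x‖} ^ (1 / p)

/-- The average `b_Q` of `b` over the cube `Q = cube c r`. -/
def cubeAvg {n : ℕ} (b : En n → ℝ) (c : En n) (r : ℝ) : ℝ :=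
  (∫ x in cube c r, b x) / (volume (cube c r)).toReal

/-- The BMO seminorm `‖b‖_*`. -/
def bmoSeminorm {n : ℕ} (b : En n → ℝ) : ℝ≥0∞ :=
  ⨆ (c : En n) (r : ℝ) (_ : 0 < r),
    (volume (cube c r))⁻¹ *
      ∫⁻ x in cube c r, (‖b x - cubeAvg b c r‖₊ : ℝ≥0∞)

/-- The Lipschitz (Hölder) seminorm `‖b‖_{Lip_α}`. -/
def lipSeminorm {n : ℕ} (α : ℝ) (b : En n → ℝ) : ℝ≥0∞ :=
  ⨆ (x : En n) (y : En n) (_ : x ≠ y),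
    (‖b x - b y‖₊ : ℝ≥0∞) / edist x y ^ α

/-- `sup_Q |Q|^{-(1+α/n)} ∫_Q |b - b_Q|`. -/
def lipAvgNorm {n : ℕ} (α : ℝ) (b : En n → ℝ) : ℝ≥0∞ :=
  ⨆ (c : En n) (r : ℝ) (_ : 0 < r),
    volume (cube c r) ^ (-(1 + α / (n : ℝ))) *
      ∫⁻ x in cube c r, (‖b x - cubeAvg b c r‖₊ : ℝ≥0∞)

theorem const_bound {p q : ℝ} (hq : 1 ≤ q) (hqp : q < p) :
    (p / (p - q)) ^ (1 / q) ≤ 2 * (q / (p - q)) ^ (1 / p) := by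
  have hq0 : 0 < q := by linarith
  have hp0 : 0 < p := by linarith
  have hd : 0 < p - q := by linarith
  have key := Real.geom_mean_le_arith_mean2_weighted (w₁ := q / p) (w₂ := (p - q) / p)
    (p₁ := p / q) (p₂ := p / (p - q)) (by positivity) (by positivity) (by positivity)
    (by positivity) (by field_simp; ring)
  have e2 : q / p * (p / q) + (p - q) / p * (p / (p - q)) = 2 := by field_simp; norm_num
  rw [e2] at key
  have e3 : p / (p - q) = ((p / q) ^ (q / p) * (p / (p - q)) ^ ((p - q) / p)) *
      (q / (p - q)) ^ (q / p) := by
    have h1 : q / (p - q) = (p / (p - q)) * (p / q)⁻¹ := by field_simp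
    rw [h1, Real.mul_rpow (by positivity) (by positivity), Real.inv_rpow (by positivity)]
    have h2 : (p / (p - q)) ^ ((p - q) / p) * (p / (p - q)) ^ (q / p) = p / (p - q) := by
      rw [← Real.rpow_add (by positivity)]
      have : (p - q) / p + q / p = 1 := by field_simp; ring
      rw [this, Real.rpow_one]
    have h3 : (p / q) ^ (q / p) ≠ 0 := by positivity
    conv_lhs => rw [← h2]
    rw [show ∀ x y z : ℝ, x * y * (z * x⁻¹) = (x * x⁻¹) * (y * z) by intros; ring,
      mul_inv_cancel₀ h3, one_mul]
  have h4 : p / (p - q) ≤ 2 * (q / (p - q)) ^ (q / p) := by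
    conv_lhs => rw [e3]
    gcongr
  calc (p / (p - q)) ^ (1 / q) ≤ (2 * (q / (p - q)) ^ (q / p)) ^ (1 / q) := by gcongr
    _ = 2 ^ (1 / q) * (q / (p - q)) ^ (1 / p) := by
      rw [Real.mul_rpow (by positivity) (by positivity), ← Real.rpow_mul (by positivity)]
      congr 2; field_simp
    _ ≤ 2 * (q / (p - q)) ^ (1 / p) := by
      gcongr
      calc (2:ℝ) ^ (1 / q) ≤ 2 ^ (1:ℝ) := by
            gcongr
            · norm_num
            · rw [div_le_one hq0]; exact hq
        _ = 2 := by simp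

theorem measurable_cube {n : ℕ} (c : En n) (r : ℝ) : IsOpen (cube c r) := by
  have : cube c r = ⋂ i, {y : En n | |y i - c i| < r} := by ext; simp [cube]
  rw [this]
  exact isOpen_iInter_of_finite fun i => isOpen_lt (by fun_prop) continuous_const

theorem cube_pos {n : ℕ} (c : En n) {r : ℝ} (hr : 0 < r) : volume (cube c r) ≠ 0 :=
  ((measurable_cube c r).measure_pos volume ⟨c, by simp [cube, hr]⟩).ne'

theorem cube_fin {n : ℕ} (c : En n) (r : ℝ) : volume (cube c r) ≠ ∞ := by
  have h : cube c r ⊆ (EuclideanSpace.equiv (Fin n) ℝ) ⁻¹' (Set.Icc (fun i => c i - r) (fun i => c i + r)) := by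
    intro y hy
    constructor <;> intro i <;> have := abs_lt.1 (hy i) <;> simp <;> linarith
  have hc : IsCompact ((EuclideanSpace.equiv (Fin n) ℝ) ⁻¹' (Set.Icc (fun i => c i - r) (fun i => c i + r))) :=
    (EuclideanSpace.equiv (Fin n) ℝ).toHomeomorph.isCompact_preimage.2 isCompact_Icc
  exact ((measure_mono h).trans_lt hc.measure_lt_top).ne

theorem layer_bound {n : ℕ} {p q : ℝ} (hq : 1 ≤ q) (hqp : q < p)
    (f : En n → ℂ) (hf : Measurable f) {a v : ℝ} (ha : 0 < a) (hv : 0 < v)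
    (hw : weakLpNorm p f ≤ ENNReal.ofReal a) (Q : Set (En n))
    (hQ : volume Q = ENNReal.ofReal v) :
    ∫⁻ y in Q, (‖f y‖₊ : ℝ≥0∞) ^ q ≤
      ENNReal.ofReal (a ^ q * v ^ (1 - q / p) * (p / (p - q))) := by
  have hq0 : 0 < q := by linarith
  have hp0 : 0 < p := by linarith
  have hd : 0 < p - q := by linarith
  have hwk : ∀ t : ℝ, 0 < t → volume {x : En n | t < ‖f x‖} ≤ ENNReal.ofReal (a ^ p * t ^ (-p)) := by
    intro t ht
    have h1 : ENNReal.ofReal t * volume {x : En n | t < ‖f x‖} ^ (1 / p) ≤ ENNReal.ofReal a :=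
      (le_iSup₂ (f := fun (t : ℝ) (_ : 0 < t) =>
        ENNReal.ofReal t * volume {x : En n | t < ‖f x‖} ^ (1 / p)) t ht).trans hw
    have h2 : volume {x : En n | t < ‖f x‖} ^ (1 / p) ≤ ENNReal.ofReal (a / t) := by
      rw [ENNReal.ofReal_div_of_pos ht]
      rw [ENNReal.le_div_iff_mul_le (by simp [ht]) (by simp), mul_comm]
      exact h1
    have h3 := ENNReal.rpow_le_rpow h2 hp0.le
    rw [← ENNReal.rpow_mul, one_div_mul_cancel hp0.ne', ENNReal.rpow_one,
      ENNReal.ofReal_rpow_of_pos (by positivity), Real.div_rpow ha.le ht.le] at h3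
    rwa [Real.rpow_neg ht.le, ← div_eq_mul_inv]
  set T : ℝ := a * v ^ (-(1 / p)) with hT
  have hT0 : 0 < T := by positivity
  have hcake := lintegral_rpow_eq_lintegral_meas_lt_mul (volume.restrict Q)
    (f := fun y => ‖f y‖) (Filter.Eventually.of_forall fun y => norm_nonneg _)
    hf.norm.aemeasurable hq0
  have hL : ∫⁻ y in Q, (‖f y‖₊ : ℝ≥0∞) ^ q = ∫⁻ y in Q, ENNReal.ofReal (‖f y‖ ^ q) := by
    congr 1; ext y
    rw [← ENNReal.ofReal_rpow_of_nonneg (norm_nonneg _) hq0.le, ofReal_norm]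
    rfl
  rw [hL, hcake]
  have I1 : ∫⁻ t in Set.Ioc 0 T, (volume.restrict Q) {y | t < ‖f y‖} * ENNReal.ofReal (t ^ (q - 1))
      ≤ ENNReal.ofReal (v * (T ^ q / q)) := by
    calc _ ≤ ∫⁻ t in Set.Ioc 0 T, ENNReal.ofReal v * ENNReal.ofReal (t ^ (q - 1)) := by
          apply lintegral_mono
          intro t
          dsimp only
          gcongr
          rw [← hQ]
          exact (measure_mono (Set.subset_univ _)).trans (by simp)
      _ = _ := by
          rw [lintegral_const_mul' _ _ (by simp), ENNReal.ofReal_mul hv.le]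
          congr 1
          have hi := (intervalIntegral.intervalIntegrable_rpow' (a := 0) (b := T) (r := q - 1) (by linarith))
          rw [intervalIntegrable_iff_integrableOn_Ioc_of_le hT0.le] at hi
          rw [← ofReal_integral_eq_lintegral_ofReal hi]
          · rw [← intervalIntegral.integral_of_le hT0.le, integral_rpow (by left; linarith)]
            simp [hq0.ne']
          · filter_upwards [ae_restrict_mem measurableSet_Ioc] with t ht
            exact Real.rpow_nonneg ht.1.le _
  have I2 : ∫⁻ t in Set.Ioi T, (volume.restrict Q) {y | t < ‖f y‖} * ENNReal.ofReal (t ^ (q - 1))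
      ≤ ENNReal.ofReal (a ^ p * (T ^ (q - p) / (p - q))) := by
    calc _ ≤ ∫⁻ t in Set.Ioi T, ENNReal.ofReal (a ^ p) * ENNReal.ofReal (t ^ (q - p - 1)) := by
          apply setLIntegral_mono' measurableSet_Ioi
          intro t ht
          have ht0 : 0 < t := hT0.trans ht
          have e : t ^ (q - p - 1) = t ^ (-p) * t ^ (q - 1) := by
            rw [← Real.rpow_add ht0]; congr 1; ring
          rw [e, ENNReal.ofReal_mul (by positivity), ← mul_assoc, ← ENNReal.ofReal_mul (by positivity)]
          gcongr
          exact (Measure.restrict_apply_le _ _).trans (hwk t ht0)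
      _ = _ := by
          rw [lintegral_const_mul' _ _ (by simp), ENNReal.ofReal_mul (by positivity)]
          congr 1
          have hi := integrableOn_Ioi_rpow_of_lt (a := q - p - 1) (by linarith) hT0
          rw [← ofReal_integral_eq_lintegral_ofReal hi]
          · rw [integral_Ioi_rpow_of_lt (by linarith) hT0]
            congr 1
            rw [sub_add_cancel, ← neg_sub p q, div_neg, neg_div, neg_neg]
          · filter_upwards [ae_restrict_mem measurableSet_Ioi] with t ht
            exact Real.rpow_nonneg (hT0.trans ht).le _
  rw [← Set.Ioc_union_Ioi_eq_Ioi hT0.le]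
  calc _ ≤ ENNReal.ofReal q * (ENNReal.ofReal (v * (T ^ q / q)) +
        ENNReal.ofReal (a ^ p * (T ^ (q - p) / (p - q)))) := by
        gcongr
        exact (lintegral_union_le _ _ _).trans (add_le_add I1 I2)
    _ = ENNReal.ofReal (q * (v * (T ^ q / q) + a ^ p * (T ^ (q - p) / (p - q)))) := by
        rw [← ENNReal.ofReal_add (by positivity) (by positivity), ← ENNReal.ofReal_mul hq0.le]
    _ = _ := by
        congr 1
        have t1 : v * T ^ q = a ^ q * v ^ (1 - q / p) := by
          rw [hT, Real.mul_rpow ha.le (by positivity), ← Real.rpow_mul hv.le, sub_eq_add_neg,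
            Real.rpow_add hv, Real.rpow_one]
          have : -(1 / p) * q = -(q / p) := by ring
          rw [this]; ring
        have t2 : a ^ p * T ^ (q - p) = a ^ q * v ^ (1 - q / p) := by
          rw [hT, Real.mul_rpow ha.le (by positivity), ← Real.rpow_mul hv.le, ← mul_assoc,
            ← Real.rpow_add ha]
          congr 2
          · ring
          · field_simp; ring
        have : q * (v * (T ^ q / q) + a ^ p * (T ^ (q - p) / (p - q))) =
          v * T ^ q + q / (p - q) * (a ^ p * T ^ (q - p)) := by field_simp
        rw [this, t1, t2]
        field_simp
        ring

/-- For `1 ≤ q < p < ∞`,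
`‖f‖_{M^p_q} ≤ 2 (q/(p - q))^{1/p} ‖f‖_{L^{p,∞}}`, so `L^{p,∞} ⊆ M^p_q`. -/
theorem morrey_le_weakLp {n : ℕ} {p q : ℝ}
    (hq : 1 ≤ q) (hqp : q < p)
    (f : En n → ℂ) (hf : Measurable f) :
    morreyNorm p q f ≤ ENNReal.ofReal (2 * (q / (p - q)) ^ (1 / p)) * weakLpNorm p f := by
  have hq0 : 0 < q := by linarith
  have hp0 : 0 < p := by linarith
  have hd : 0 < p - q := by linarith
  have hC : 0 < 2 * (q / (p - q)) ^ (1 / p) := by positivity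
  have main : ∀ a : ℝ, 0 < a → weakLpNorm p f ≤ ENNReal.ofReal a →
      morreyNorm p q f ≤ ENNReal.ofReal (2 * (q / (p - q)) ^ (1 / p)) * ENNReal.ofReal a := by
    intro a ha hw
    refine iSup_le fun c => iSup_le fun r => iSup_le fun hr => ?_
    set v := (volume (cube c r)).toReal with hvdef
    have hQ : volume (cube c r) = ENNReal.ofReal v := (ENNReal.ofReal_toReal (cube_fin c r)).symm
    have hv : 0 < v := ENNReal.toReal_pos (cube_pos c hr) (cube_fin c r)
    have hb := layer_bound hq hqp f hf ha hv hw (cube c r) hQ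
    rw [hQ, ENNReal.ofReal_rpow_of_pos hv]
    calc _ ≤ ENNReal.ofReal (v ^ (1 / p - 1 / q)) *
          (ENNReal.ofReal (a ^ q * v ^ (1 - q / p) * (p / (p - q)))) ^ (1 / q) := by gcongr
      _ = ENNReal.ofReal ((p / (p - q)) ^ (1 / q) * a) := by
          rw [ENNReal.ofReal_rpow_of_pos (by positivity), ← ENNReal.ofReal_mul (by positivity)]
          congr 1
          rw [Real.mul_rpow (by positivity) (by positivity),
            Real.mul_rpow (by positivity) (by positivity), ← Real.rpow_mul ha.le,
            ← Real.rpow_mul hv.le, mul_one_div_cancel hq0.ne', Real.rpow_one]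
          have h1 : v ^ (1 / p - 1 / q) * v ^ ((1 - q / p) * (1 / q)) = 1 := by
            rw [← Real.rpow_add hv]
            have : 1 / p - 1 / q + (1 - q / p) * (1 / q) = 0 := by field_simp; ring
            rw [this, Real.rpow_zero]
          linear_combination (a * (p / (p - q)) ^ (1 / q)) * h1
      _ ≤ _ := by
          rw [← ENNReal.ofReal_mul hC.le]
          have := const_bound hq hqp
          gcongr
  have hC0 : ENNReal.ofReal (2 * (q / (p - q)) ^ (1 / p)) ≠ 0 := by simpa using hC
  rw [mul_comm, ← ENNReal.div_le_iff hC0 ENNReal.ofReal_ne_top]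
  refine le_of_forall_gt_imp_ge_of_dense fun b hb => ?_
  rw [ENNReal.div_le_iff hC0 ENNReal.ofReal_ne_top, mul_comm]
  by_cases hbt : b = ∞
  · rw [hbt, ENNReal.mul_top hC0]; exact le_top
  · have hb0 : b ≠ 0 := (bot_le.trans_lt hb).ne'
    have := main b.toReal (ENNReal.toReal_pos hb0 hbt) (by rw [ENNReal.ofReal_toReal hbt]; exact hb.le)
    rwa [ENNReal.ofReal_toReal hbt] at this
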